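/- arXiv:1705.04268 — 2 statements merged into one kernel-verified Lean document; each statement's English description precedes it below -/
import Mathlib

section
/- (Differential equation (A3) for the coordinate functions x, y, z of the Ree curve.) For each p ∈ {p_x, p_y, p_z}, the identity D^q p + ℓ^q0 * D^(q+q0) p + ℓ^(2q0) * D^(q+2q0) p + ℓ^(3q0) * D^(q+3q0) p = 0 holds in F[X]. -/
noncomputable section

open Polynomial

abbrev F := ZMod 3

def q0 (s : ℕ) : ℕ := 3 ^ s
def q (s : ℕ) : ℕ := 3 ^ (2 * s + 1)

def pX : Polynomial F := X
def pY (s : ℕ) : Polynomial F :=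
  X ^ (q0 s + 1) - X ^ (q s + q0 s) + X ^ (q s * (q0 s + 1)) - X ^ (q s * (q s + q0 s))
def pZ (s : ℕ) : Polynomial F :=
  X ^ (2 * q0 s + 1) - X ^ (q s + 2 * q0 s) + X ^ (q s * (2 * q0 s + 1)) - X ^ (q s * (q s + 2 * q0 s))
def ell (s : ℕ) : Polynomial F := X ^ q s - X

theorem one_add_X_pow_three (m : ℕ) : ((1 + X : Polynomial F)) ^ (3 ^ m) = 1 + X ^ (3 ^ m) := by
  rw [add_pow_expChar_pow (p := 3), one_pow]

theorem sizes (s : ℕ) (hs : 1 ≤ s) :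
    3 ≤ q0 s ∧ 9 * q0 s ≤ q s ∧ 3 * q s ≤ q s * q0 s ∧ 3 * (q s * q0 s) ≤ q s * q s := by
  have h1 : 3 ≤ q0 s := by
    unfold q0
    calc 3 = 3 ^ 1 := by norm_num
      _ ≤ 3 ^ s := Nat.pow_le_pow_right (by norm_num) hs
  have h2 : q s = 3 * q0 s * q0 s := by
    unfold q q0; ring
  have h3 : 9 * q0 s ≤ q s := by rw [h2]; nlinarith
  refine ⟨h1, h3, ?_, ?_⟩ <;> nlinarith

theorem hd (n k : ℕ) : hasseDeriv k (X ^ n : Polynomial F)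
    = C (((1 + X : Polynomial F) ^ n).coeff k) * X ^ (n - k) := by
  rw [← monomial_one_right_eq_X_pow, hasseDeriv_monomial, coeff_one_add_X_pow, C_mul_X_pow_eq_monomial,
    mul_one]

theorem base_a (s : ℕ) : (1 + X : Polynomial F) ^ (q0 s) = 1 + X ^ (q0 s) :=
  one_add_X_pow_three _
theorem base_q (s : ℕ) : (1 + X : Polynomial F) ^ (q s) = 1 + X ^ (q s) :=
  one_add_X_pow_three _
theorem base_qa (s : ℕ) : (1 + X : Polynomial F) ^ (q s * q0 s) = 1 + X ^ (q s * q0 s) := by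
  unfold q q0; rw [← pow_add]; exact one_add_X_pow_three _
theorem base_qq (s : ℕ) : (1 + X : Polynomial F) ^ (q s * q s) = 1 + X ^ (q s * q s) := by
  unfold q; rw [← pow_add]; exact one_add_X_pow_three _

theorem ell_pow (s : ℕ) : ell s ^ q0 s = X ^ (q s * q0 s) - X ^ q0 s := by
  unfold ell
  rw [pow_mul]
  exact sub_pow_expChar_pow (p := 3) _ _ _

theorem core (a q r t : ℕ) (h1 : 3 ≤ a) (h2 : 9 * a ≤ q) (h3 : 3 * q ≤ r) (h4 : 3 * r ≤ t)
    (ba : (1 + X : Polynomial F) ^ a = 1 + X ^ a) (bq : (1 + X : Polynomial F) ^ q = 1 + X ^ q)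
    (br : (1 + X : Polynomial F) ^ r = 1 + X ^ r) (bt : (1 + X : Polynomial F) ^ t = 1 + X ^ t)
    (l p : Polynomial F) (hl : l = X ^ r - X ^ a)
    (hp : p = X ∨ p = X ^ (a + 1) - X ^ (q + a) + X ^ (r + q) - X ^ (t + r) ∨
      p = X ^ (2 * a + 1) - X ^ (q + 2 * a) + X ^ (2 * r + q) - X ^ (t + 2 * r)) :
    hasseDeriv q p + l * hasseDeriv (q + a) p + l ^ 2 * hasseDeriv (q + 2 * a) p
      + l ^ 3 * hasseDeriv (q + 3 * a) p = 0 := by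
  have small : ∀ n k : ℕ, n < k → hasseDeriv k (X ^ n : Polynomial F) = 0 := by
    intro n k h
    apply hasseDeriv_eq_zero_of_lt_natDegree
    simpa using h
  have e1 : (1 + X : Polynomial F) ^ (q + a) = 1 + X ^ q + X ^ a + X ^ (q + a) := by
    rw [pow_add, ba, bq]; ring
  have e2 : (1 + X : Polynomial F) ^ (r + q) = 1 + X ^ q + X ^ r + X ^ (r + q) := by
    rw [pow_add, br, bq]; ring
  have e3 : (1 + X : Polynomial F) ^ (t + r) = 1 + X ^ t + X ^ r + X ^ (t + r) := by
    rw [pow_add, bt, br]; ring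
  have e4 : (1 + X : Polynomial F) ^ (q + 2 * a) = 1 + X ^ a + X ^ a + X ^ (2 * a) + X ^ q
      + X ^ (q + a) + X ^ (q + a) + X ^ (q + 2 * a) := by
    rw [pow_add, mul_comm 2 a, pow_mul, ba, bq]; ring
  have e5 : (1 + X : Polynomial F) ^ (2 * r + q) = 1 + X ^ r + X ^ r + X ^ (2 * r) + X ^ q
      + X ^ (r + q) + X ^ (r + q) + X ^ (2 * r + q) := by
    rw [pow_add, mul_comm 2 r, pow_mul, br, bq]; ring
  have e6 : (1 + X : Polynomial F) ^ (t + 2 * r) = 1 + X ^ r + X ^ r + X ^ (2 * r) + X ^ t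
      + X ^ (t + r) + X ^ (t + r) + X ^ (t + 2 * r) := by
    rw [pow_add, mul_comm 2 r, pow_mul, br, bt]; ring
  have c : ∀ m k : ℕ, m ≠ k → (X ^ m : Polynomial F).coeff k = 0 := by
    intro m k h
    rw [coeff_X_pow, if_neg (Ne.symm h)]
  have c1 : ∀ k : ℕ, 0 < k → (1 : Polynomial F).coeff k = 0 := by
    intro k h
    rw [coeff_one, if_neg (by omega)]
  rcases hp with rfl | rfl | rfl
  · have := small 1
    simp only [pow_one] at this
    rw [this _ (by omega), this _ (by omega), this _ (by omega), this _ (by omega)]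
    simp
  · have A : ∀ k, q ≤ k → k ≤ q + 3 * a → hasseDeriv k (X ^ (a + 1) - X ^ (q + a) + X ^ (r + q)
        - X ^ (t + r) : Polynomial F) = - (C ((X ^ q : Polynomial F).coeff k
          + (X ^ (q + a) : Polynomial F).coeff k) * X ^ (q + a - k))
          + C ((X ^ q : Polynomial F).coeff k) * X ^ (r + q - k) := by
      intro k hk hk'
      rw [map_sub, map_add, map_sub, small (a + 1) k (by omega), hd, hd, hd, e1, e2, e3]
      simp only [coeff_add]
      rw [c1 k (by omega), c a k (by omega), c r k (by omega), c (r + q) k (by omega),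
        c t k (by omega), c (t + r) k (by omega)]
      simp
    rw [A _ (by omega) (by omega), A _ (by omega) (by omega), A _ (by omega) (by omega),
      A _ (by omega) (by omega), c q (q + a) (by omega), c q (q + 2 * a) (by omega),
      c q (q + 3 * a) (by omega), c (q + a) q (by omega), c (q + a) (q + 2 * a) (by omega),
      c (q + a) (q + 3 * a) (by omega), hl]
    simp
  · have A : ∀ k, q ≤ k → k ≤ q + 3 * a → hasseDeriv k (X ^ (2 * a + 1) - X ^ (q + 2 * a)
        + X ^ (2 * r + q) - X ^ (t + 2 * r) : Polynomial F) = - (C ((X ^ q : Polynomial F).coeff k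
          + (X ^ (q + a) : Polynomial F).coeff k + (X ^ (q + a) : Polynomial F).coeff k
          + (X ^ (q + 2 * a) : Polynomial F).coeff k) * X ^ (q + 2 * a - k))
          + C ((X ^ q : Polynomial F).coeff k) * X ^ (2 * r + q - k) := by
      intro k hk hk'
      rw [map_sub, map_add, map_sub, small (2 * a + 1) k (by omega), hd, hd, hd, e4, e5, e6]
      simp only [coeff_add]
      rw [c1 k (by omega), c a k (by omega), c (2 * a) k (by omega), c r k (by omega),
        c (r + q) k (by omega), c (2 * r) k (by omega), c (2 * r + q) k (by omega),
        c t k (by omega), c (t + r) k (by omega), c (t + 2 * r) k (by omega)]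
      simp
    rw [A _ (by omega) (by omega), A _ (by omega) (by omega), A _ (by omega) (by omega),
      A _ (by omega) (by omega), c q (q + a) (by omega), c q (q + 2 * a) (by omega),
      c q (q + 3 * a) (by omega), c (q + a) q (by omega), c (q + a) (q + 2 * a) (by omega),
      c (q + a) (q + 3 * a) (by omega), c (q + 2 * a) q (by omega),
      c (q + 2 * a) (q + a) (by omega), c (q + 2 * a) (q + 3 * a) (by omega), hl,
      show q + 2 * a - q = 2 * a by omega, show q + 2 * a - (q + a) = a by omega,
      show q + 2 * a - (q + 2 * a) = 0 by omega, show 2 * r + q - q = 2 * r by omega]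
    simp only [coeff_X_pow_self, map_add, map_zero, map_one]
    ring

theorem stmt9 (s : ℕ) (hs : 1 ≤ s) (p : Polynomial F)
    (hp : p = pX ∨ p = pY s ∨ p = pZ s) :
    hasseDeriv (q s) p + ell s ^ q0 s * hasseDeriv (q s + q0 s) p
      + ell s ^ (2 * q0 s) * hasseDeriv (q s + 2 * q0 s) p
      + ell s ^ (3 * q0 s) * hasseDeriv (q s + 3 * q0 s) p = 0 := by
  obtain ⟨h1, h2, h3, h4⟩ := sizes s hs
  rw [mul_comm 2 (q0 s), mul_comm 3 (q0 s), pow_mul, pow_mul, mul_comm (q0 s) 2,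
    mul_comm (q0 s) 3]
  refine core _ _ _ _ h1 h2 h3 h4 (base_a s) (base_q s) (base_qa s) (base_qq s) _ p (ell_pow s) ?_
  rcases hp with h | h | h
  · exact Or.inl h
  · right; left
    rw [h, pY, show q s * (q0 s + 1) = q s * q0 s + q s by ring, mul_add]
  · right; right
    rw [h, pZ, show q s * (2 * q0 s + 1) = 2 * (q s * q0 s) + q s by ring,
      show q s * (q s + 2 * q0 s) = q s * q s + 2 * (q s * q0 s) by ring]
end
end

section
/- (Differential equation (A7) for the coordinate functions x, y, z of the Ree curve.) For each p ∈ {p_x, p_y, p_z}, the identity ℓ^(2q0) * D^(q*q0+2q0) p - ℓ^q0 * D^(q*q0+q0) p = ℓ^q * (D^(q0+1) p + D^(q+q0) p) holds in F[X]. -/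
noncomputable section

open Polynomial

lemma hd_aux (i n : ℕ) : hasseDeriv i (X ^ n : Polynomial F)
    = C (((1 + X : Polynomial F) ^ n).coeff i) * X ^ (n - i) := by
  rw [coeff_one_add_X_pow, X_pow_eq_monomial, hasseDeriv_monomial, X_pow_eq_monomial,
    C_mul_monomial]

lemma frob_aux (k : ℕ) : (1 + X : Polynomial F) ^ (3 ^ k) = 1 + X ^ (3 ^ k) := by
  rw [add_pow_char_pow, one_pow]

/-- Expansion for exponents with digits 1,1. -/
lemma hd_one (A B i : ℕ) (hA : ∃ k, A = 3 ^ k) (hB : ∃ k, B = 3 ^ k) :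
    hasseDeriv i (X ^ (A + B) : Polynomial F)
    = C ((if i = 0 then 1 else 0) + (if i = A then 1 else 0) + (if i = B then 1 else 0)
        + (if i = A + B then 1 else 0)) * X ^ (A + B - i) := by
  have h : (1 + X : Polynomial F) ^ (A + B) = X ^ 0 + X ^ A + X ^ B + X ^ (A + B) := by
    obtain ⟨k, rfl⟩ := hA
    obtain ⟨l, rfl⟩ := hB
    rw [pow_add, frob_aux, frob_aux, pow_add]; ring
  rw [hd_aux, h]
  simp only [coeff_add, coeff_X_pow]

/-- Expansion for exponents with digits 2,1. -/
lemma hd_two (A B i : ℕ) (hA : ∃ k, A = 3 ^ k) (hB : ∃ k, B = 3 ^ k) :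
    hasseDeriv i (X ^ (2 * A + B) : Polynomial F)
    = C ((if i = 0 then 1 else 0) + 2 * (if i = A then 1 else 0) + (if i = 2 * A then 1 else 0)
        + (if i = B then 1 else 0) + 2 * (if i = A + B then 1 else 0)
        + (if i = 2 * A + B then 1 else 0)) * X ^ (2 * A + B - i) := by
  have h : (1 + X : Polynomial F) ^ (2 * A + B) = X ^ 0 + C 2 * X ^ A + X ^ (2 * A)
      + X ^ B + C 2 * X ^ (A + B) + X ^ (2 * A + B) := by
    obtain ⟨k, rfl⟩ := hA
    obtain ⟨l, rfl⟩ := hB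
    have h2 : (C 2 : Polynomial F) = 2 := rfl
    rw [h2, pow_add, mul_comm 2, pow_mul, frob_aux, frob_aux]; ring
  rw [hd_aux, h]
  simp only [coeff_add, coeff_X_pow, coeff_C_mul]

theorem stmt13 (s : ℕ) (hs : 1 ≤ s) (p : Polynomial F)
    (hp : p = pX ∨ p = pY s ∨ p = pZ s) :
    ell s ^ (2 * q0 s) * hasseDeriv (q s * q0 s + 2 * q0 s) p
      - ell s ^ q0 s * hasseDeriv (q s * q0 s + q0 s) p
    = ell s ^ q s * (hasseDeriv (q0 s + 1) p + hasseDeriv (q s + q0 s) p) := by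
  have p1 : ∃ k, 1 = 3 ^ k := ⟨0, rfl⟩
  have pa : ∃ k, q0 s = 3 ^ k := ⟨s, rfl⟩
  have pq : ∃ k, q s = 3 ^ k := ⟨2 * s + 1, rfl⟩
  have pP : ∃ k, q s * q0 s = 3 ^ k := ⟨2 * s + 1 + s, by rw [pow_add]; rfl⟩
  have pR : ∃ k, q s * q s = 3 ^ k := ⟨(2 * s + 1) + (2 * s + 1), by rw [pow_add]; rfl⟩
  have ha : 3 ≤ q0 s := by
    calc 3 = 3 ^ 1 := rfl
      _ ≤ 3 ^ s := Nat.pow_le_pow_right (by norm_num) hs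
  have hq : q s = 3 * (q0 s * q0 s) := by
    unfold q q0; ring
  have hqa : 9 * q0 s ≤ q s := by nlinarith
  have hP : 3 * q s ≤ q s * q0 s := by nlinarith
  have hR : 9 * (q s * q0 s) ≤ q s * q s := by nlinarith
  have eY : pY s = X ^ (q0 s + 1) - X ^ (q s + q0 s) + X ^ (q s * q0 s + q s)
      - X ^ (q s * q s + q s * q0 s) := by
    unfold pY; ring
  have eZ : pZ s = X ^ (2 * q0 s + 1) - X ^ (2 * q0 s + q s) + X ^ (2 * (q s * q0 s) + q s)
      - X ^ (2 * (q s * q0 s) + q s * q s) := by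
    unfold pZ; ring
  generalize q s * q0 s = P at *
  generalize q s * q s = R at *
  generalize ell s = l at *
  generalize q s = Q at *
  generalize q0 s = a at *
  clear hq
  have key : hasseDeriv (P + 2 * a) p = 0 ∧ hasseDeriv (P + a) p = 0 ∧
      hasseDeriv (a + 1) p + hasseDeriv (Q + a) p = 0 := by
    rcases hp with rfl | rfl | rfl
    · unfold pX
      refine ⟨?_, ?_, ?_⟩
      · exact hasseDeriv_X _ (by omega)
      · exact hasseDeriv_X _ (by omega)
      · rw [hasseDeriv_X _ (by omega), hasseDeriv_X _ (by omega), add_zero]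
    · rw [eY]
      simp only [map_sub, map_add (hasseDeriv _), hd_one _ _ _ pa p1, hd_one _ _ _ pq pa,
        hd_one _ _ _ pP pq, hd_one _ _ _ pR pP]
      refine ⟨?_, ?_, ?_⟩
      · repeat rw [if_neg (by omega)]
        simp
      · repeat rw [if_neg (by omega)]
        simp
      · simp only [if_true]
        repeat rw [if_neg (by omega)]
        simp
    · rw [eZ]
      simp only [map_sub, map_add (hasseDeriv _), hd_two _ _ _ pa p1, hd_two _ _ _ pa pq,
        hd_two _ _ _ pP pq, hd_two _ _ _ pP pR]
      refine ⟨?_, ?_, ?_⟩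
      · repeat rw [if_neg (by omega)]
        simp
      · repeat rw [if_neg (by omega)]
        simp
      · simp only [if_true]; rw [if_pos (by omega : Q + a = a + Q)]
        repeat rw [if_neg (by omega)]
        rw [show 2 * a + 1 - (a + 1) = a by omega, show 2 * a + Q - (Q + a) = a by omega]
        simp
  obtain ⟨h1, h2, h3⟩ := key
  rw [h1, h2, h3]; simp
end
end
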